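/- Let θ : P → Q be a Kummer homomorphism of fine saturated commutative monoids, i.e., θ is injective and for every q ∈ Q there exists a positive integer n such that n·q lies in the image θ(P). Then the summation homomorphism η : Q ⊕_P Q → Q, induced by (a,b) ↦ a + b, is strict; that is, the induced homomorphism of sharp quotients (Q ⊕_P Q)/(Q ⊕_P Q)^* → Q/Q^* is an isomorphism, where Q ⊕_P Q denotes the pushout of θ with itself in the category of fine saturated monoids and M^* denotes the submonoid of invertible elements of a monoid M. -/

import Mathlib

/-- A cancellative commutative monoid is saturated if whenever some positive power of `a`
is divisible by the same power of `b`, then `a` is divisible by `b`.  (For a cancellative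
monoid `M` this is equivalent to the usual condition that any element `x` of the group
completion with `n • x ∈ M` for some `n > 0` already lies in `M`.) -/
def IsSaturatedMonoid (M : Type) [CommMonoid M] : Prop :=
  ∀ a b : M, (∃ n : ℕ, 0 < n ∧ ∃ c : M, a ^ n = c * b ^ n) → ∃ d : M, a = d * b

/-- The units of a finitely generated commutative monoid form a finitely generated submonoid. -/
theorem fg_isUnit_submonoid (M : Type*) [CommMonoid M] [Monoid.FG M] :
    (IsUnit.submonoid M).FG := by
  obtain ⟨S, hS, hfin⟩ := (Submonoid.fg_iff _).1 (Monoid.FG.fg_top (M := M))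
  refine (Submonoid.fg_iff _).2 ⟨{s ∈ S | IsUnit s}, le_antisymm ?_ ?_, hfin.subset fun _ h => h.1⟩
  · exact Submonoid.closure_le.2 fun s hs => hs.2
  · intro u hu
    have h : u ∈ Submonoid.closure S := hS ▸ Submonoid.mem_top u
    induction h using Submonoid.closure_induction with
    | mem x hx => exact Submonoid.subset_closure ⟨hx, hu⟩
    | one => exact Submonoid.one_mem _
    | mul x y _ _ ihx ihy =>
      have hxy : IsUnit x ∧ IsUnit y := IsUnit.mul_iff.1 hu
      exact Submonoid.mul_mem _ (ihx hxy.1) (ihy hxy.2)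

/-- In a saturated cancellative monoid, elements with a common positive power are associated. -/
theorem IsSaturatedMonoid.associated_of_pow_eq {M : Type} [CancelCommMonoid M]
    (hM : IsSaturatedMonoid M) {a b : M} {n : ℕ} (hn : 0 < n) (h : a ^ n = b ^ n) :
    Associated a b := by
  obtain ⟨c, hc⟩ := hM a b ⟨n, hn, 1, by rw [one_mul, h]⟩
  obtain ⟨d, hd⟩ := hM b a ⟨n, hn, 1, by rw [one_mul, h]⟩
  have hcd : c * d = 1 := by
    refine mul_right_cancel (b := a) ?_
    rw [mul_assoc, ← hd, ← hc, one_mul]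
  exact Associated.symm ⟨⟨c, d, hcd, by rw [mul_comm, hcd]⟩, by rw [hc, mul_comm]⟩

instance Submonoid.instCancelCommMonoid {M : Type*} [CancelCommMonoid M] (S : Submonoid M) :
    CancelCommMonoid S :=
  { S.toCommMonoid with
    mul_left_cancel := fun _ _ _ h => Subtype.ext (mul_left_cancel (congrArg Subtype.val h)) }

/-- The submonoid of elements that an endomorphism preserves up to a unit. -/
def associatedFixed {M : Type*} [CommMonoid M] (f : M →* M) : Submonoid M where
  carrier := {v | Associated v (f v)}
  one_mem' := by simp
  mul_mem' {a b} ha hb := by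
    simpa only [Set.mem_ofPred_eq, map_mul] using Associated.mul_mul ha hb

theorem mem_associatedFixed {M : Type*} [CommMonoid M] {f : M →* M} {v : M} :
    v ∈ associatedFixed f ↔ Associated v (f v) := Iff.rfl

theorem IsSaturatedMonoid.associatedFixed {M : Type} [CancelCommMonoid M]
    (hM : IsSaturatedMonoid M) (f : M →* M) : IsSaturatedMonoid (associatedFixed f) := by
  rintro ⟨a, ha⟩ ⟨b, hb⟩ ⟨n, hn, ⟨c, _⟩, h⟩
  obtain ⟨d, rfl⟩ := hM a b ⟨n, hn, c, congrArg Subtype.val h⟩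
  refine ⟨⟨d, ?_⟩, rfl⟩
  rw [mem_associatedFixed] at *
  obtain ⟨u, hu⟩ := ha
  obtain ⟨w, hw⟩ := hb
  refine ⟨u * w⁻¹, mul_right_cancel (b := b * w) ?_⟩
  calc d * ↑(u * w⁻¹) * (b * w) = d * b * u * (↑w⁻¹ * w) := by push_cast; ac_rfl
    _ = f d * (b * w) := by rw [Units.inv_mul, mul_one, hu, map_mul, hw]

/-- If `j` is a section of `η`, then the elements preserved by `j ∘ η` up to a unit are the
products of a unit and an element of the range of `j`. -/
theorem associatedFixed_comp_eq {M N : Type*} [CommMonoid M] [CommMonoid N]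
    {j : N →* M} {η : M →* N} (h : η.comp j = MonoidHom.id N) :
    associatedFixed (j.comp η) = IsUnit.submonoid M ⊔ MonoidHom.mrange j := by
  refine le_antisymm ?_ (sup_le ?_ ?_)
  · intro v hv
    obtain ⟨u, hu⟩ := (mem_associatedFixed.1 hv).symm
    exact Submonoid.mem_sup.2 ⟨u, u.isUnit, _, ⟨η v, rfl⟩, by rw [mul_comm]; exact hu⟩
  · intro u hu
    have hu : IsUnit u := hu
    exact (associated_one_iff_isUnit.2 hu).trans
      (associated_one_iff_isUnit.2 (hu.map (j.comp η))).symm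
  · rintro _ ⟨q, rfl⟩
    have hq : η (j q) = q := DFunLike.congr_fun h q
    rw [mem_associatedFixed, MonoidHom.comp_apply, hq]

/-- Statement 19: let `θ : P → Q` be a Kummer homomorphism of fine saturated commutative
monoids (injective, and every element of `Q` has a positive power in the image of `θ`).
Let `V`, with the two coprojections `j₁ j₂ : Q → V`, be the pushout `Q ⊕_P Q` of `θ` with
itself in the category of fine saturated monoids (characterized by its universal property),
and let `η : V → Q` be the summation homomorphism, i.e. the homomorphism satisfying
`η ∘ j₁ = id` and `η ∘ j₂ = id`.  Then `η` is strict: the induced homomorphism of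
quotients by the submonoids of units `V/V* → Q/Q*` is an isomorphism (stated elementwise as
injectivity and surjectivity modulo units). -/
theorem kummer_pushout_summation_strict
    (P Q V : Type) [CancelCommMonoid P] [CancelCommMonoid Q] [CancelCommMonoid V]
    [Monoid.FG P] [Monoid.FG Q] [Monoid.FG V]
    (hPsat : IsSaturatedMonoid P) (hQsat : IsSaturatedMonoid Q)
    (hVsat : IsSaturatedMonoid V)
    (θ : P →* Q) (hinj : Function.Injective θ)
    (hkummer : ∀ q : Q, ∃ n : ℕ, 0 < n ∧ q ^ n ∈ Set.range θ)
    (j₁ j₂ : Q →* V) (hj : j₁.comp θ = j₂.comp θ)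
    (huniv : ∀ (W : Type) [CancelCommMonoid W], Monoid.FG W → IsSaturatedMonoid W →
      ∀ (k₁ k₂ : Q →* W), k₁.comp θ = k₂.comp θ →
        ∃! φ : V →* W, φ.comp j₁ = k₁ ∧ φ.comp j₂ = k₂)
    (η : V →* Q) (hη₁ : η.comp j₁ = MonoidHom.id Q) (hη₂ : η.comp j₂ = MonoidHom.id Q) :
    (∀ v w : V, η v = η w → ∃ u₁ u₂ : V, IsUnit u₁ ∧ IsUnit u₂ ∧ v * u₁ = w * u₂) ∧
    (∀ q : Q, ∃ (v : V) (u : Q), IsUnit u ∧ η v * u = q) := by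
  have h₁ : ∀ q, η (j₁ q) = q := DFunLike.congr_fun hη₁
  have h₂ : ∀ q, η (j₂ q) = q := DFunLike.congr_fun hη₂
  have hj₁ : ∀ q, j₁ q ∈ associatedFixed (j₁.comp η) := fun q => by
    rw [mem_associatedFixed, MonoidHom.comp_apply, h₁]
  have hj₂ : ∀ q, j₂ q ∈ associatedFixed (j₁.comp η) := fun q => by
    rw [mem_associatedFixed, MonoidHom.comp_apply, h₂]
    obtain ⟨n, hn, p, hp⟩ := hkummer q
    refine hVsat.associated_of_pow_eq hn ?_
    rw [← map_pow, ← map_pow, ← hp]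
    exact (DFunLike.congr_fun hj p).symm
  have hfg : Monoid.FG (associatedFixed (j₁.comp η)) := by
    rw [Monoid.fg_iff_submonoid_fg, associatedFixed_comp_eq hη₁]
    refine (fg_isUnit_submonoid V).sup ?_
    rw [MonoidHom.mrange_eq_map]
    exact (Monoid.FG.fg_top (M := Q)).map j₁
  have hcomp : (j₁.codRestrict _ hj₁).comp θ = (j₂.codRestrict _ hj₂).comp θ :=
    MonoidHom.ext fun p => Subtype.ext (DFunLike.congr_fun hj p)
  obtain ⟨φ, ⟨hφ₁, hφ₂⟩, -⟩ :=
    huniv (associatedFixed (j₁.comp η)) hfg (hVsat.associatedFixed _) _ _ hcomp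
  have hφ : (Submonoid.subtype _).comp φ = MonoidHom.id V :=
    (huniv V inferInstance hVsat j₁ j₂ hj).unique
      ⟨by rw [MonoidHom.comp_assoc, hφ₁]; rfl, by rw [MonoidHom.comp_assoc, hφ₂]; rfl⟩
      ⟨MonoidHom.id_comp _, MonoidHom.id_comp _⟩
  have hassoc : ∀ v : V, Associated v (j₁ (η v)) := fun v => by
    have hv : (φ v : V) = v := DFunLike.congr_fun hφ v
    exact mem_associatedFixed.1 (hv ▸ (φ v).2)
  refine ⟨fun v w h => ?_, fun q => ⟨j₁ q, 1, isUnit_one, by rw [h₁, mul_one]⟩⟩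
  obtain ⟨u, hu⟩ := hassoc v
  obtain ⟨u', hu'⟩ := hassoc w
  exact ⟨u, u', u.isUnit, u'.isUnit, by rw [hu, hu', h]⟩
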